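/- Let N ≥ 1 and z ∈ ℝ^N with z ≠ 0. Then the map exp_0 is Fréchet differentiable at z and its derivative is the linear map v ↦ B(z)·v + (A(z) − C(z))·⟨z, v⟩·z, where A(z) = 2/(|z|²(1 + cosh(2|z|))), B(z) = sinh(2|z|)/(|z|(1 + cosh(2|z|))), and C(z) = sinh(2|z|)/(|z|³(1 + cosh(2|z|))). -/

import Mathlib

open scoped RealInnerProductSpace

/-- The exponential map at the origin of the Poincaré ball model:
`exp_0(z) = (sinh(2|z|)/((1 + cosh(2|z|)) |z|)) • z`, with `exp_0(0) = 0`. -/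
noncomputable def expZero {N : ℕ} (z : EuclideanSpace ℝ (Fin N)) : EuclideanSpace ℝ (Fin N) :=
  (Real.sinh (2 * ‖z‖) / ((1 + Real.cosh (2 * ‖z‖)) * ‖z‖)) • z

/-- `A(z) = 2/(|z|²(1 + cosh 2|z|))`. -/
noncomputable def coefA {N : ℕ} (z : EuclideanSpace ℝ (Fin N)) : ℝ :=
  2 / (‖z‖ ^ 2 * (1 + Real.cosh (2 * ‖z‖)))

/-- `B(z) = sinh(2|z|)/(|z|(1 + cosh 2|z|))`. -/
noncomputable def coefB {N : ℕ} (z : EuclideanSpace ℝ (Fin N)) : ℝ :=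
  Real.sinh (2 * ‖z‖) / (‖z‖ * (1 + Real.cosh (2 * ‖z‖)))

/-- `C(z) = sinh(2|z|)/(|z|³(1 + cosh 2|z|))`. -/
noncomputable def coefC {N : ℕ} (z : EuclideanSpace ℝ (Fin N)) : ℝ :=
  Real.sinh (2 * ‖z‖) / (‖z‖ ^ 3 * (1 + Real.cosh (2 * ‖z‖)))

/-- Away from the origin, the norm of a real inner product space has derivative
`v ↦ ⟪z, v⟫ / ‖z‖`. -/
theorem hasFDerivAt_norm_of_ne_zero {E : Type*} [NormedAddCommGroup E] [InnerProductSpace ℝ E]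
    {z : E} (hz : z ≠ 0) :
    HasFDerivAt (fun x : E => ‖x‖) (‖z‖⁻¹ • innerSL ℝ z) z := by
  have hsq : ‖z‖ ^ 2 ≠ 0 := pow_ne_zero 2 (norm_ne_zero_iff.mpr hz)
  have h := (hasStrictFDerivAt_norm_sq z).hasFDerivAt.sqrt hsq
  simp only [Real.sqrt_sq (norm_nonneg _)] at h
  refine h.congr_fderiv ?_
  ext v
  simp
  ring

/-- The derivative of the radial profile of `expZero`. -/
theorem hasDerivAt_sinh_div_one_add_cosh_mul {r : ℝ} (hr : r ≠ 0) :
    HasDerivAt (fun t : ℝ => Real.sinh (2 * t) / ((1 + Real.cosh (2 * t)) * t))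
      (2 / (r * (1 + Real.cosh (2 * r))) - Real.sinh (2 * r) / (r ^ 2 * (1 + Real.cosh (2 * r))))
      r := by
  have hc : 1 + Real.cosh (2 * r) ≠ 0 := by positivity
  have h2 : HasDerivAt (fun t : ℝ => 2 * t) 2 r := by
    simpa using (hasDerivAt_id r).const_mul 2
  have h := h2.sinh.fun_div ((h2.cosh.const_add 1).fun_mul (hasDerivAt_id' r)) (mul_ne_zero hc hr)
  refine h.congr_deriv ?_
  have hsc := Real.cosh_sq (2 * r)
  field_simp
  linear_combination 2 * r * hsc

/-- At every `z ≠ 0`, `exp_0` is Fréchet differentiable and its derivative is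
`v ↦ B(z) v + (A(z) - C(z)) ⟨z, v⟩ z`. -/
theorem fderiv_expZero
    (N : ℕ) (hN : 1 ≤ N) (z : EuclideanSpace ℝ (Fin N)) (hz : z ≠ 0) :
    DifferentiableAt ℝ expZero z ∧
      ∀ v : EuclideanSpace ℝ (Fin N),
        fderiv ℝ expZero z v = coefB z • v + ((coefA z - coefC z) * ⟪z, v⟫) • z := by
  have hr : ‖z‖ ≠ 0 := norm_ne_zero_iff.mpr hz
  have hc : 1 + Real.cosh (2 * ‖z‖) ≠ 0 := by positivity
  have h : HasFDerivAt expZero _ z :=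
    ((hasDerivAt_sinh_div_one_add_cosh_mul hr).comp_hasFDerivAt z
      (hasFDerivAt_norm_of_ne_zero hz)).fun_smul (hasFDerivAt_id z)
  refine ⟨h.differentiableAt, fun v => ?_⟩
  rw [h.fderiv]
  simp only [add_apply, smul_apply,
    ContinuousLinearMap.smulRight_apply, ContinuousLinearMap.id_apply, innerSL_apply_apply,
    Function.comp_apply, smul_eq_mul, coefA, coefB, coefC]
  congr 2
  · rw [mul_comm ‖z‖]
  · field_simp
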